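/- Let G be a group acting on a set X, and let F₁, F₂ be fundamental sets for subgroups Γ₁, Γ₂ ≤ G respectively. If d ∈ Γ₁ ∩ Γ₂ and Ψ ⊆ X satisfies Ψ ⊆ ⋃_{n ∈ ℤ} dⁿ(Φ) for some Φ ⊆ X with Φ ⊆ ⋃_{n ∈ ℤ} dⁿ(Ψ), and Ψ is a fundamental set for Γ₁, and Φ contains no two distinct ⟨d⟩-equivalent points, then Φ is a fundamental set for Γ₁. -/

import Mathlib

open scoped Pointwise

/-- `F` is a fundamental set for the action of the subgroup `Γ` of `G` on `X`: it meets
every `Γ`-orbit and contains no two distinct points in the same `Γ`-orbit. -/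
def IsFundamentalSetFor {G X : Type*} [Group G] [MulAction G X]
    (Γ : Subgroup G) (F : Set X) : Prop :=
  (∀ x : X, ∃ γ ∈ Γ, γ • x ∈ F) ∧
  (∀ x ∈ F, ∀ y ∈ F, (∃ γ ∈ Γ, γ • x = y) → x = y)

/-- Let `G` act on `X`, with `F₁`, `F₂` fundamental sets for subgroups `Γ₁`, `Γ₂`, and
`d ∈ Γ₁ ∩ Γ₂`. If `Ψ ⊆ ⋃ₙ dⁿ • Φ` and `Φ ⊆ ⋃ₙ dⁿ • Ψ`, `Ψ` is a fundamental set for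
`Γ₁`, and `Φ` contains no two distinct `⟨d⟩`-equivalent points, then `Φ` is a
fundamental set for `Γ₁`. -/
theorem stmt_18 {G X : Type*} [Group G] [MulAction G X]
    (Γ₁ Γ₂ : Subgroup G) (F₁ F₂ Ψ Φ : Set X)
    (hF₁ : IsFundamentalSetFor Γ₁ F₁) (hF₂ : IsFundamentalSetFor Γ₂ F₂)
    (d : G) (hd : d ∈ Γ₁ ⊓ Γ₂)
    (hΨΦ : Ψ ⊆ ⋃ n : ℤ, (d ^ n) • Φ)
    (hΦΨ : Φ ⊆ ⋃ n : ℤ, (d ^ n) • Ψ)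
    (hΨfund : IsFundamentalSetFor Γ₁ Ψ)
    (hΦd : ∀ x ∈ Φ, ∀ y ∈ Φ, (∃ n : ℤ, (d ^ n) • x = y) → x = y) :
    IsFundamentalSetFor Γ₁ Φ := by
  have hd1 : d ∈ Γ₁ := hd.1
  refine ⟨fun x => ?_, fun x hx y hy h => ?_⟩
  · obtain ⟨γ, hγ, hx⟩ := hΨfund.1 x
    obtain ⟨n, z, hz, hzx⟩ := Set.mem_iUnion.1 (hΨΦ hx)
    have hzx : d ^ n • z = γ • x := hzx
    refine ⟨(d ^ n)⁻¹ * γ, Γ₁.mul_mem (Γ₁.inv_mem (Γ₁.zpow_mem hd1 n)) hγ, ?_⟩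
    rw [mul_smul, ← hzx, inv_smul_smul]
    exact hz
  · obtain ⟨γ, hγ, hxy⟩ := h
    obtain ⟨n, a, ha, hax⟩ := Set.mem_iUnion.1 (hΦΨ hx)
    obtain ⟨m, b, hb, hby⟩ := Set.mem_iUnion.1 (hΦΨ hy)
    have hax : d ^ n • a = x := hax
    have hby : d ^ m • b = y := hby
    have hab : a = b := by
      refine hΨfund.2 a ha b hb ⟨(d ^ m)⁻¹ * γ * d ^ n,
        Γ₁.mul_mem (Γ₁.mul_mem (Γ₁.inv_mem (Γ₁.zpow_mem hd1 m)) hγ) (Γ₁.zpow_mem hd1 n), ?_⟩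
      rw [mul_smul, mul_smul, hax, hxy, ← hby, inv_smul_smul]
    refine hΦd x hx y hy ⟨m - n, ?_⟩
    rw [zpow_sub, mul_smul, ← hax, inv_smul_smul, hab, hby]
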